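/- arXiv:1404.4860 — 8 statements merged into one kernel-verified Lean document; each statement's English description precedes it below -/
import Mathlib

section
/- Let φ be a flow on a generalized Peano continuum M. Suppose K is a nonempty compact invariant set, (Λₙ) is a sequence of compact minimal sets with d_H(Λₙ, K) → 0, and K′ is a nonempty compact invariant set with K′ ⊊ K (proper subset). Then K′ is Lyapunov unstable. -/
open Set Filter Topology Metric TopologicalSpace

variable {M : Type*} [MetricSpace M]

/-- A set is invariant under the flow `φ`. -/
def IsFlowInvariant (φ : ℝ → M → M) (K : Set M) : Prop :=
  ∀ x ∈ K, ∀ t : ℝ, φ t x ∈ K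

/-- A set is positively invariant under the flow `φ`. -/
def IsPosInvariant (φ : ℝ → M → M) (K : Set M) : Prop :=
  ∀ x ∈ K, ∀ t : ℝ, 0 ≤ t → φ t x ∈ K

/-- A compact minimal set: nonempty, compact, invariant, with no nonempty proper
closed invariant subset. -/
def IsCompactMinimalSet (φ : ℝ → M → M) (K : Set M) : Prop :=
  K.Nonempty ∧ IsCompact K ∧ IsFlowInvariant φ K ∧
    ∀ K' ⊆ K, K'.Nonempty → IsClosed K' → IsFlowInvariant φ K' → K' = K

/-- Lyapunov stability: every neighborhood of `K` contains a positively invariant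
neighborhood of `K`. -/
def IsLyapunovStable (φ : ℝ → M → M) (K : Set M) : Prop :=
  ∀ U ∈ 𝓝ˢ K, ∃ V ∈ 𝓝ˢ K, V ⊆ U ∧ IsPosInvariant φ V

/-- The ω-limit set of a point. -/
def omegaLimitSet (φ : ℝ → M → M) (x : M) : Set M :=
  ⋂ T ∈ Ici (0 : ℝ), closure ((fun t => φ t x) '' Ici T)

/-- The α-limit set of a point. -/
def alphaLimitSet (φ : ℝ → M → M) (x : M) : Set M :=
  ⋂ T ∈ Iic (0 : ℝ), closure ((fun t => φ t x) '' Iic T)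

/-- A compact minimal set is hyper-stable if some neighborhood of it in `M` meets no
Lyapunov unstable compact minimal set. -/
def IsHyperStable (φ : ℝ → M → M) (Λ : Set M) : Prop :=
  IsCompactMinimalSet φ Λ ∧ ∃ W ∈ 𝓝ˢ Λ, ∀ Γ : Set M,
    IsCompactMinimalSet φ Γ → ¬ IsLyapunovStable φ Γ → Γ ∩ W = ∅

/-- The forward orbit of any point of a compact minimal set is dense in it. -/
theorem IsCompactMinimalSet.subset_closure_image_Ici {φ : ℝ → M → M}
    (hφcont : Continuous fun p : ℝ × M => φ p.1 p.2)
    (hφzero : ∀ x : M, φ 0 x = x)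
    (hφadd : ∀ s t : ℝ, ∀ x : M, φ s (φ t x) = φ (s + t) x)
    {Λ : Set M} (hΛ : IsCompactMinimalSet φ Λ) {z : M} (hz : z ∈ Λ) :
    Λ ⊆ closure ((fun t => φ t z) '' Ici 0) := by
  obtain ⟨-, hcomp, hinv, hmin⟩ := hΛ
  let F : Flow ℝ M :=
    { toFun := φ
      cont' := hφcont
      map_add' := fun s t x => (hφadd s t x).symm
      map_zero' := hφzero }
  have hsub : ∀ v : Set ℝ, closure (image2 F v {z}) ⊆ Λ := fun v =>
    closure_minimal (image2_subset_iff.2 fun t _ y hy => by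
      rw [mem_singleton_iff.1 hy]; exact hinv z hz t) hcomp.isClosed
  have hω : omegaLimit atTop F {z} = Λ := by
    refine hmin _ ?_ ?_ (isClosed_omegaLimit _ _ _) ?_
    · exact (iInter₂_subset univ univ_mem).trans (hsub univ)
    · exact nonempty_omegaLimit_of_isCompact_absorbing atTop F {z} hcomp
        ⟨univ, univ_mem, hsub univ⟩ (singleton_nonempty z)
    · intro x hx t
      exact F.isInvariant_omegaLimit atTop {z}
        (fun t => tendsto_atTop_add_const_left _ t tendsto_id) t hx
  rw [← hω]
  refine (iInter₂_subset (Ici 0) (Ici_mem_atTop 0)).trans ?_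
  rw [image2_singleton_right]

theorem lyapunov_unstable_of_proper_subset_of_hausdorff_limit [LocallyCompactSpace M] [ConnectedSpace M] [LocallyConnectedSpace M]
    (φ : ℝ → M → M)
    (hφcont : Continuous fun p : ℝ × M => φ p.1 p.2)
    (hφzero : ∀ x : M, φ 0 x = x)
    (hφadd : ∀ s t : ℝ, ∀ x : M, φ s (φ t x) = φ (s + t) x)
    (K : Set M) (hKne : K.Nonempty) (hKcomp : IsCompact K) (hKinv : IsFlowInvariant φ K)
    (Λ : ℕ → Set M) (hΛ : ∀ n, IsCompactMinimalSet φ (Λ n))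
    (hconv : Filter.Tendsto (fun n => hausdorffDist (Λ n) K) Filter.atTop (𝓝 0))
    (K' : Set M) (hK'ne : K'.Nonempty) (hK'comp : IsCompact K')
    (hK'inv : IsFlowInvariant φ K') (hK'ss : K' ⊂ K) :
    ¬ IsLyapunovStable φ K' := by
  intro hstab
  obtain ⟨x, hxK, hxK'⟩ := exists_of_ssubset hK'ss
  obtain ⟨y, hy⟩ := hK'ne
  obtain ⟨r, hr, hdisj⟩ := Metric.mem_nhds_iff.1 (hK'comp.isClosed.isOpen_compl.mem_nhds hxK')
  have hW : (closedBall x (r / 2))ᶜ ∈ 𝓝ˢ K' :=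
    isClosed_closedBall.isOpen_compl.mem_nhdsSet.2 fun p hp hpx =>
      hdisj (closedBall_subset_ball (half_lt_self hr) hpx) hp
  obtain ⟨V, hV, hVU, hVinv⟩ := hstab _ hW
  obtain ⟨ε, hε, hεV⟩ := Metric.mem_nhds_iff.1 (mem_nhdsSet_iff_forall.1 hV y hy)
  obtain ⟨n, hn⟩ := (hconv.eventually_lt_const (lt_min hε (half_pos hr))).exists
  have hfin := hausdorffEDist_ne_top_of_nonempty_of_bounded (hΛ n).1 hKne
    (hΛ n).2.1.isBounded hKcomp.isBounded
  obtain ⟨z, hz, hzy⟩ := exists_dist_lt_of_hausdorffDist_lt' (hK'ss.subset hy)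
    (hn.trans_le (min_le_left _ _)) hfin
  obtain ⟨w, hw, hwx⟩ := exists_dist_lt_of_hausdorffDist_lt' hxK
    (hn.trans_le (min_le_right _ _)) hfin
  obtain ⟨_, hb, t, ht, rfl⟩ := mem_closure_iff.1
    ((hΛ n).subset_closure_image_Ici hφcont hφzero hφadd hz hw) _ isOpen_ball hwx
  exact hVU (hVinv z (hεV hzy) t ht) (ball_subset_closedBall hb)
end

section
/- Let φ be a flow on a generalized Peano continuum M and let x ∈ M be such that ω(x) is nonempty and compact. If K′ is a nonempty compact invariant set with K′ ⊊ ω(x) (proper subset), then K′ is Lyapunov unstable. -/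
open Set Filter Topology Metric TopologicalSpace

variable {M : Type*} [MetricSpace M]

/-- A point of the ω-limit set is approached along the forward orbit at arbitrarily late times. -/
theorem exists_le_mem_of_mem_omegaLimitSet {φ : ℝ → M → M} {x y : M}
    (hy : y ∈ omegaLimitSet φ x) {U : Set M} (hU : U ∈ 𝓝 y) {T : ℝ} (hT : 0 ≤ T) :
    ∃ t, T ≤ t ∧ φ t x ∈ U := by
  obtain ⟨_, hz, t, ht, rfl⟩ := mem_closure_iff_nhds.1 (mem_iInter₂.1 hy T hT) U hU
  exact ⟨t, ht, hz⟩

theorem lyapunov_unstable_of_proper_subset_of_omegaLimit [LocallyCompactSpace M] [ConnectedSpace M] [LocallyConnectedSpace M]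
    (φ : ℝ → M → M)
    (hφcont : Continuous fun p : ℝ × M => φ p.1 p.2)
    (hφzero : ∀ x : M, φ 0 x = x)
    (hφadd : ∀ s t : ℝ, ∀ x : M, φ s (φ t x) = φ (s + t) x)
    (x : M) (hωne : (omegaLimitSet φ x).Nonempty) (hωcomp : IsCompact (omegaLimitSet φ x))
    (K' : Set M) (hK'ne : K'.Nonempty) (hK'comp : IsCompact K')
    (hK'inv : IsFlowInvariant φ K') (hK'ss : K' ⊂ omegaLimitSet φ x) :
    ¬ IsLyapunovStable φ K' := by
  intro hstable
  obtain ⟨p, hp, hpK⟩ := exists_of_ssubset hK'ss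
  obtain ⟨y, hy⟩ := hK'ne
  obtain ⟨A, B, hA, hB, hKA, hpB, hAB⟩ :=
    SeparatedNhds.of_isCompact_isCompact hK'comp isCompact_singleton
      (disjoint_singleton_right.2 hpK)
  obtain ⟨V, hV, hVA, hVpos⟩ := hstable A (hA.mem_nhdsSet.2 hKA)
  obtain ⟨t, ht, htV⟩ :=
    exists_le_mem_of_mem_omegaLimitSet (hK'ss.1 hy) (mem_nhdsSet_iff_forall.1 hV y hy) le_rfl
  obtain ⟨s, hs, hsB⟩ :=
    exists_le_mem_of_mem_omegaLimitSet hp (hB.mem_nhds (singleton_subset_iff.1 hpB)) ht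
  have hsV := hVpos _ htV (s - t) (sub_nonneg.2 hs)
  rw [hφadd, sub_add_cancel] at hsV
  exact disjoint_left.1 hAB (hVA hsV) hsB
end

section
/- Let φ be a flow on a generalized Peano continuum M and let x ∈ M be such that α(x) is nonempty and compact. If K is a nonempty compact invariant set with K ⊆ α(x) and K is Lyapunov stable, then x ∈ K and K = α(x). -/
open Set Filter Topology Metric TopologicalSpace

variable {M : Type*} [MetricSpace M]

theorem mem_and_eq_alphaLimit_of_stable_subset [LocallyCompactSpace M] [ConnectedSpace M] [LocallyConnectedSpace M]
    (φ : ℝ → M → M)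
    (hφcont : Continuous fun p : ℝ × M => φ p.1 p.2)
    (hφzero : ∀ x : M, φ 0 x = x)
    (hφadd : ∀ s t : ℝ, ∀ x : M, φ s (φ t x) = φ (s + t) x)
    (x : M) (hαne : (alphaLimitSet φ x).Nonempty) (hαcomp : IsCompact (alphaLimitSet φ x))
    (K : Set M) (hKne : K.Nonempty) (hKcomp : IsCompact K) (hKinv : IsFlowInvariant φ K)
    (hKsub : K ⊆ alphaLimitSet φ x) (hKstab : IsLyapunovStable φ K) :
    x ∈ K ∧ K = alphaLimitSet φ x := by
  have hK (s : ℝ) : φ s x ∈ K := by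
    by_contra hs
    obtain ⟨V, hV, hVU, hVinv⟩ := hKstab {φ s x}ᶜ <|
      isOpen_compl_singleton.mem_nhdsSet.2 fun z hz hzs => hs (hzs ▸ hz)
    obtain ⟨y, hy⟩ := hKne
    have hycl : y ∈ closure ((fun t => φ t x) '' Iic (min s 0)) :=
      mem_iInter₂.1 (hKsub hy) (min s 0) (min_le_right s 0)
    obtain ⟨_, hzV, t, ht, rfl⟩ :=
      mem_closure_iff_nhds.1 hycl V (mem_nhdsSet_iff_forall.1 hV y hy)
    have hts : t ≤ s := le_trans ht (min_le_left s 0)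
    have hsV := hVinv _ hzV (s - t) (sub_nonneg.2 hts)
    rw [hφadd, sub_add_cancel] at hsV
    exact hVU hsV rfl
  refine ⟨hφzero x ▸ hK 0, hKsub.antisymm fun z hz => ?_⟩
  have hzcl : z ∈ closure ((fun t => φ t x) '' Iic 0) := mem_iInter₂.1 hz 0 self_mem_Iic
  exact closure_minimal (image_subset_iff.2 fun t _ => hK t) hKcomp.isClosed hzcl
end

section
/- Let φ be a non-wandering flow on a generalized Peano continuum M and let x ∈ M be such that ω(x) is nonempty and compact. If ω(x) is Lyapunov stable, then x ∈ ω(x). -/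
open Set Filter Topology Metric TopologicalSpace

variable {M : Type*} [MetricSpace M]

/-- An attractor: a Lyapunov stable nonempty compact invariant set whose basin of
attraction is a neighborhood of it. -/
def IsAttractorSet (φ : ℝ → M → M) (Δ : Set M) : Prop :=
  Δ.Nonempty ∧ IsCompact Δ ∧ IsFlowInvariant φ Δ ∧ IsLyapunovStable φ Δ ∧
    {x : M | (omegaLimitSet φ x).Nonempty ∧ omegaLimitSet φ x ⊆ Δ} ∈ 𝓝ˢ Δ

/-- The flow is non-wandering. -/
def IsNonWanderingFlow (φ : ℝ → M → M) : Prop :=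
  ∀ x : M, ∀ U ∈ 𝓝 x, ∀ T > (0 : ℝ), ∃ t ≥ T, ((fun y => φ t y) '' U ∩ U).Nonempty

/-- The set of hyper-stable compact minimal sets, as a subset of the space of nonempty
compact subsets of `M` (with the Hausdorff metric). -/
def HSset (φ : ℝ → M → M) : Set (NonemptyCompacts M) :=
  {Γ | IsHyperStable φ (Γ : Set M)}

/-- The set of all compact minimal sets, as a subset of the space of nonempty compact
subsets of `M` (with the Hausdorff metric). -/
def CMinSet (φ : ℝ → M → M) : Set (NonemptyCompacts M) :=
  {Γ | IsCompactMinimalSet φ (Γ : Set M)}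

/-- `basinOf φ X` is the set of points whose ω-limit set belongs to `X`. -/
def basinOf (φ : ℝ → M → M) (X : Set (NonemptyCompacts M)) : Set M :=
  {x | ∃ Γ ∈ X, (Γ : Set M) = omegaLimitSet φ x}

/-- The union in `M` of a family of hyper-stable compact minimal sets. -/
def unionSet (φ : ℝ → M → M) (X : Set ↥(HSset φ)) : Set M :=
  {y | ∃ q ∈ X, y ∈ ((q : NonemptyCompacts M) : Set M)}

theorem mem_omegaLimit_of_stable_nonwandering [LocallyCompactSpace M] [ConnectedSpace M] [LocallyConnectedSpace M]
    (φ : ℝ → M → M)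
    (hφcont : Continuous fun p : ℝ × M => φ p.1 p.2)
    (hφzero : ∀ x : M, φ 0 x = x)
    (hφadd : ∀ s t : ℝ, ∀ x : M, φ s (φ t x) = φ (s + t) x)
    (hnw : IsNonWanderingFlow φ)
    (x : M) (hωne : (omegaLimitSet φ x).Nonempty) (hωcomp : IsCompact (omegaLimitSet φ x))
    (hωstab : IsLyapunovStable φ (omegaLimitSet φ x)) :
    x ∈ omegaLimitSet φ x := by
  by_contra hx
  obtain ⟨U, W, hUo, hWo, hKU, hxW, hUW⟩ :=
    SeparatedNhds.of_isCompact_isClosed hωcomp isClosed_singleton (disjoint_singleton_right.2 hx)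
  obtain ⟨V, hV, hVU, hVpos⟩ := hωstab U (hUo.mem_nhdsSet.2 hKU)
  obtain ⟨p, hp⟩ := hωne
  have hpV : interior V ∈ 𝓝 p :=
    isOpen_interior.mem_nhds (subset_interior_iff_mem_nhdsSet.2 hV hp)
  have hpcl : p ∈ closure ((fun t => φ t x) '' Ici 1) :=
    mem_iInter₂.1 hp 1 (mem_Ici.2 zero_le_one)
  obtain ⟨_, hTV, T, hT, rfl⟩ := mem_closure_iff_nhds.1 hpcl _ hpV
  have hTcont : Continuous fun y => φ T y := hφcont.comp (Continuous.prodMk_right T)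
  have hN : W ∩ (fun y => φ T y) ⁻¹' interior V ∈ 𝓝 x :=
    inter_mem (hWo.mem_nhds (hxW rfl))
      (hTcont.continuousAt.preimage_mem_nhds (isOpen_interior.mem_nhds hTV))
  obtain ⟨t, ht, _, ⟨y, hy, rfl⟩, hty⟩ := hnw x _ hN T (zero_lt_one.trans_le hT)
  have hback : φ t y ∈ V := by
    simpa [hφadd] using hVpos _ (interior_subset hy.2) (t - T) (sub_nonneg.2 ht)
  exact disjoint_left.1 hUW (hVU hback) hty.1
end

section
/- Let φ be a flow on a generalized Peano continuum M and let Λ be a hyper-stable compact minimal set. Then for every neighborhood W of Λ in M there exists a set U ⊆ W that is a neighborhood of Λ in M, is compact, connected and positively invariant, and is such that every compact minimal set contained in U is hyper-stable. -/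
open Set Filter Topology Metric TopologicalSpace

variable {M : Type*} [MetricSpace M]

theorem IsPosInvariant.closure {φ : ℝ → M → M} (hφ : ∀ t, Continuous (φ t)) {K : Set M}
    (hK : IsPosInvariant φ K) : IsPosInvariant φ (closure K) := fun _ hx t ht =>
  map_mem_closure (hφ t) hx fun y hy => hK y hy t ht

/-- A compact minimal set is the closure of each of its orbits. -/
theorem IsCompactMinimalSet.closure_orbit_eq {φ : ℝ → M → M} (hφ : ∀ t, Continuous (φ t))
    (hφadd : ∀ s t : ℝ, ∀ x : M, φ s (φ t x) = φ (s + t) x) {K : Set M}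
    (hK : IsCompactMinimalSet φ K) {x : M} (hx : x ∈ K) :
    closure (range fun t => φ t x) = K := by
  obtain ⟨-, hcomp, hinv, hmin⟩ := hK
  refine hmin _ (closure_minimal ?_ hcomp.isClosed) (range_nonempty _).closure isClosed_closure ?_
  · rintro _ ⟨t, rfl⟩
    exact hinv x hx t
  · intro y hy s
    refine map_mem_closure (hφ s) hy ?_
    rintro _ ⟨t, rfl⟩
    exact ⟨s + t, (hφadd s t x).symm⟩

theorem IsCompactMinimalSet.isConnected {φ : ℝ → M → M}
    (hφcont : Continuous fun p : ℝ × M => φ p.1 p.2)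
    (hφadd : ∀ s t : ℝ, ∀ x : M, φ s (φ t x) = φ (s + t) x) {K : Set M}
    (hK : IsCompactMinimalSet φ K) : IsConnected K := by
  obtain ⟨x, hx⟩ := hK.1
  rw [← hK.closure_orbit_eq (fun t => hφcont.comp (Continuous.prodMk_right t)) hφadd hx]
  exact (isConnected_range (hφcont.comp (Continuous.prodMk_left x))).closure

theorem IsPosInvariant.connectedComponentIn {φ : ℝ → M → M}
    (hφcont : Continuous fun p : ℝ × M => φ p.1 p.2) (hφzero : ∀ x : M, φ 0 x = x)
    {V : Set M} (hV : IsPosInvariant φ V) (p : M) :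
    IsPosInvariant φ (connectedComponentIn V p) := by
  intro x hx t ht
  have hxV : x ∈ V := connectedComponentIn_subset V p hx
  rw [connectedComponentIn_eq hx]
  have hpre : IsPreconnected ((fun s => φ s x) '' Ici (0 : ℝ)) :=
    isPreconnected_Ici.image _ (hφcont.comp (Continuous.prodMk_left x)).continuousOn
  refine hpre.subset_connectedComponentIn ⟨0, mem_Ici.2 le_rfl, hφzero x⟩ ?_ ⟨t, ht, rfl⟩
  rintro _ ⟨s, hs, rfl⟩
  exact hV x hxV s hs

theorem hyperStable_has_small_posInvariant_nbhds [LocallyCompactSpace M] [ConnectedSpace M] [LocallyConnectedSpace M]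
    (φ : ℝ → M → M)
    (hφcont : Continuous fun p : ℝ × M => φ p.1 p.2)
    (hφzero : ∀ x : M, φ 0 x = x)
    (hφadd : ∀ s t : ℝ, ∀ x : M, φ s (φ t x) = φ (s + t) x)
    (Λ : Set M) (hΛ : IsHyperStable φ Λ) :
    ∀ W ∈ 𝓝ˢ Λ, ∃ U : Set M, U ⊆ W ∧ U ∈ 𝓝ˢ Λ ∧ IsCompact U ∧ IsConnected U ∧
      IsPosInvariant φ U ∧ ∀ Γ : Set M, Γ ⊆ U → IsCompactMinimalSet φ Γ → IsHyperStable φ Γ := by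
  intro W hW
  obtain ⟨hmin, N, hN, hNstable⟩ := hΛ
  have hconn : IsConnected Λ := hmin.isConnected hφcont hφadd
  obtain ⟨p, hp⟩ := hmin.1
  have hstable : IsLyapunovStable φ Λ := by
    by_contra h
    have hpN : p ∈ Λ ∩ N := ⟨hp, subset_of_mem_nhdsSet hN hp⟩
    rw [hNstable Λ hmin h] at hpN
    exact hpN
  obtain ⟨C, hC, hΛC, hCNW⟩ := exists_compact_between hmin.2.1 isOpen_interior
    (subset_interior_iff_mem_nhdsSet.2 (inter_mem hN hW))
  obtain ⟨V, hV, hVC, hVinv⟩ := hstable C (subset_interior_iff_mem_nhdsSet.1 hΛC)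
  have hUC : closure (connectedComponentIn V p) ⊆ C :=
    closure_minimal ((connectedComponentIn_subset V p).trans hVC) hC.isClosed
  have hΛV : Λ ⊆ V := subset_of_mem_nhdsSet hV
  have hΛU : Λ ⊆ connectedComponentIn V p :=
    hconn.isPreconnected.subset_connectedComponentIn hp hΛV
  refine ⟨closure (connectedComponentIn V p), fun x hx => (interior_subset (hCNW (hUC hx))).2,
    ?_, hC.of_isClosed_subset isClosed_closure hUC,
    (isConnected_connectedComponentIn_iff.2 (hΛV hp)).closure,
    (hVinv.connectedComponentIn hφcont hφzero p).closure
      fun t => hφcont.comp (Continuous.prodMk_right t), ?_⟩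
  · refine mem_nhdsSet_iff_forall.2 fun x hx => mem_of_superset ?_ subset_closure
    rw [connectedComponentIn_eq (hΛU hx)]
    exact connectedComponentIn_mem_nhds (mem_nhdsSet_iff_forall.1 hV x hx)
  · intro Γ hΓU hΓ
    exact ⟨hΓ, N, subset_interior_iff_mem_nhdsSet.1 fun x hx =>
      interior_mono inter_subset_left (hCNW (hUC (hΓU hx))), hNstable⟩
end

section
/- Let φ be a flow on a generalized Peano continuum M and let U be a nonempty, compact, connected, positively invariant subset of M such that every compact minimal set contained in U is hyper-stable. Then for every x ∈ U, ω(x) is nonempty and is a compact minimal set contained in U (hence hyper-stable). -/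
open Set Filter Topology Metric TopologicalSpace

variable {M : Type*} [MetricSpace M]

theorem omegaLimitSet_subset_closure_image (φ : ℝ → M → M) (x : M) {T : ℝ} (hT : 0 ≤ T) :
    omegaLimitSet φ x ⊆ closure ((fun t => φ t x) '' Ici T) :=
  biInter_subset_of_mem (mem_Ici.2 hT)

theorem isClosed_omegaLimitSet (φ : ℝ → M → M) (x : M) : IsClosed (omegaLimitSet φ x) :=
  isClosed_biInter fun _ _ => isClosed_closure

theorem isFlowInvariant_omegaLimitSet {φ : ℝ → M → M} (hφcont : ∀ t, Continuous (φ t))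
    (hφadd : ∀ s t : ℝ, ∀ x : M, φ s (φ t x) = φ (s + t) x) (x : M) :
    IsFlowInvariant φ (omegaLimitSet φ x) := by
  intro y hy t
  refine mem_iInter₂.2 fun T _ => ?_
  have hy' := omegaLimitSet_subset_closure_image φ x (le_max_right (T - t) 0) hy
  refine map_mem_closure (hφcont t) hy' ?_
  rintro _ ⟨s, hs, rfl⟩
  have hs' : T - t ≤ s := (le_max_left _ _).trans (mem_Ici.1 hs)
  exact ⟨t + s, mem_Ici.2 (by linarith), (hφadd t s x).symm⟩

theorem omegaLimitSet_subset_of_isPosInvariant {φ : ℝ → M → M} {U : Set M} (hU : IsClosed U)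
    (hUpos : IsPosInvariant φ U) {x : M} (hx : x ∈ U) : omegaLimitSet φ x ⊆ U := by
  refine (omegaLimitSet_subset_closure_image φ x le_rfl).trans (closure_minimal ?_ hU)
  rintro _ ⟨t, ht, rfl⟩
  exact hUpos x hx t ht

theorem omegaLimitSet_nonempty_of_isPosInvariant {φ : ℝ → M → M} {U : Set M} (hU : IsCompact U)
    (hUpos : IsPosInvariant φ U) {x : M} (hx : x ∈ U) : (omegaLimitSet φ x).Nonempty := by
  have hle : map (fun t => φ t x) atTop ≤ 𝓟 U := by
    refine le_principal_iff.2 (mem_map.2 ?_)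
    filter_upwards [eventually_ge_atTop (0 : ℝ)] with t ht using hUpos x hx t ht
  obtain ⟨y, -, hy⟩ := hU hle
  exact ⟨y, mem_iInter₂.2 fun T _ => mem_closure_iff_clusterPt.2 <|
    hy.mono (le_principal_iff.2 (image_mem_map (Ici_mem_atTop T)))⟩

theorem IsCompact.exists_isCompactMinimalSet_subset {φ : ℝ → M → M} {K : Set M}
    (hK : IsCompact K) (hne : K.Nonempty) (hinv : IsFlowInvariant φ K) :
    ∃ Γ ⊆ K, IsCompactMinimalSet φ Γ := by
  obtain ⟨Γ, hΓK, hΓ⟩ := zorn_superset_nonempty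
    {A : Set M | A.Nonempty ∧ IsCompact A ∧ IsFlowInvariant φ A} (fun c hc hchain hcne => by
      refine ⟨⋂₀ c, ⟨?_, ?_, ?_⟩, fun s hs => sInter_subset_of_mem hs⟩
      · have : Nonempty c := hcne.to_subtype
        exact IsCompact.nonempty_sInter_of_directed_nonempty_isCompact_isClosed
          (fun A hA B hB => (hchain.total hA hB).elim
            (fun h => ⟨A, hA, subset_rfl, h⟩) (fun h => ⟨B, hB, h, subset_rfl⟩)) (fun A hA => (hc hA).1) (fun A hA => (hc hA).2.1)
          (fun A hA => (hc hA).2.1.isClosed)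
      · obtain ⟨A, hA⟩ := hcne
        exact (hc hA).2.1.of_isClosed_subset
          (isClosed_sInter fun B hB => (hc hB).2.1.isClosed) (sInter_subset_of_mem hA)
      · exact fun y hy t A hA => (hc hA).2.2 y (hy A hA) t) K ⟨hne, hK, hinv⟩
  refine ⟨Γ, hΓK, hΓ.prop.1, hΓ.prop.2.1, hΓ.prop.2.2, fun A hA hAne hAcl hAinv => ?_⟩
  exact hA.antisymm (hΓ.le_of_le ⟨hAne, hΓ.prop.2.1.of_isClosed_subset hAcl hA, hAinv⟩ hA)

theorem IsHyperStable.isLyapunovStable {φ : ℝ → M → M} {Γ : Set M} (h : IsHyperStable φ Γ) :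
    IsLyapunovStable φ Γ := by
  obtain ⟨hΓ, W, hW, hdisj⟩ := h
  by_contra hunst
  have hempty := hdisj Γ hΓ hunst
  rw [inter_eq_left.2 (subset_of_mem_nhdsSet hW)] at hempty
  exact hΓ.1.ne_empty hempty

theorem IsLyapunovStable.omegaLimitSet_subset {φ : ℝ → M → M}
    (hφadd : ∀ s t : ℝ, ∀ x : M, φ s (φ t x) = φ (s + t) x) {Γ : Set M}
    (hstab : IsLyapunovStable φ Γ) (hΓ : IsCompact Γ) {x : M}
    (hmeet : (Γ ∩ omegaLimitSet φ x).Nonempty) : omegaLimitSet φ x ⊆ Γ := by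
  intro y hy
  by_contra hyΓ
  obtain ⟨O, P, hO, hP, hΓO, hyP, hOP⟩ :=
    SeparatedNhds.of_isCompact_isCompact hΓ (isCompact_singleton (x := y))
      (disjoint_singleton_right.2 hyΓ)
  obtain ⟨V, hV, hVO, hVpos⟩ := hstab O (hO.mem_nhdsSet.2 hΓO)
  obtain ⟨p, hpΓ, hpω⟩ := hmeet
  obtain ⟨_, hpV, t, ht, rfl⟩ := mem_closure_iff_nhds.1
    (omegaLimitSet_subset_closure_image φ x le_rfl hpω) V (mem_nhdsSet_iff_forall.1 hV p hpΓ)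
  obtain ⟨_, hqP, s, hs, rfl⟩ := mem_closure_iff.1
    (omegaLimitSet_subset_closure_image φ x ht hy) P hP (hyP rfl)
  have hsV := hVpos _ hpV (s - t) (sub_nonneg.2 hs)
  rw [hφadd, sub_add_cancel] at hsV
  exact disjoint_left.1 hOP (hVO hsV) hqP

theorem omegaLimit_is_hyperStable_minimal_in_U [LocallyCompactSpace M] [ConnectedSpace M] [LocallyConnectedSpace M]
    (φ : ℝ → M → M)
    (hφcont : Continuous fun p : ℝ × M => φ p.1 p.2)
    (hφzero : ∀ x : M, φ 0 x = x)
    (hφadd : ∀ s t : ℝ, ∀ x : M, φ s (φ t x) = φ (s + t) x)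
    (U : Set M) (hUne : U.Nonempty) (hUcomp : IsCompact U) (hUconn : IsConnected U)
    (hUpos : IsPosInvariant φ U)
    (hmin : ∀ Γ : Set M, Γ ⊆ U → IsCompactMinimalSet φ Γ → IsHyperStable φ Γ) :
    ∀ x ∈ U, (omegaLimitSet φ x).Nonempty ∧ IsCompactMinimalSet φ (omegaLimitSet φ x) ∧
      omegaLimitSet φ x ⊆ U ∧ IsHyperStable φ (omegaLimitSet φ x) := by
  intro x hx
  have hsub := omegaLimitSet_subset_of_isPosInvariant hUcomp.isClosed hUpos hx
  have hne := omegaLimitSet_nonempty_of_isPosInvariant hUcomp hUpos hx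
  obtain ⟨Γ, hΓω, hΓ⟩ :=
    (hUcomp.of_isClosed_subset (isClosed_omegaLimitSet φ x) hsub).exists_isCompactMinimalSet_subset
      hne (isFlowInvariant_omegaLimitSet (fun t => by fun_prop) hφadd x)
  have hstable := hmin Γ (hΓω.trans hsub) hΓ
  obtain ⟨p, hp⟩ := hΓ.1
  have hωΓ := hstable.isLyapunovStable.omegaLimitSet_subset hφadd hΓ.2.1 ⟨p, hp, hΓω hp⟩
  obtain rfl := hΓω.antisymm hωΓ
  exact ⟨hne, hΓ, hsub, hstable⟩
end

section
/- Let φ be a flow on a generalized Peano continuum M and let U be a nonempty, compact, connected, positively invariant subset of M such that every compact minimal set contained in U is hyper-stable. Then the set of compact minimal sets contained in U, regarded as a subset of the space of nonempty compact subsets of M with the Hausdorff metric d_H, is compact and connected. -/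
open Set Filter Topology Metric TopologicalSpace

variable {M : Type*} [MetricSpace M]

open scoped omegaLimit

theorem IsFlowInvariant.exists_compactMinimalSet_subset {φ : ℝ → M → M} {K : Set M}
    (hinv : IsFlowInvariant φ K) (hne : K.Nonempty) (hK : IsCompact K) :
    ∃ Γ ⊆ K, IsCompactMinimalSet φ Γ := by
  obtain ⟨Γ, hΓK, hΓ⟩ := zorn_superset_nonempty
    {L : Set M | L.Nonempty ∧ IsCompact L ∧ IsFlowInvariant φ L} (fun c hc hchain hcne => by
      have : Nonempty c := hcne.to_subtype
      refine ⟨⋂₀ c, ⟨?_, ?_, ?_⟩, fun s hs => sInter_subset_of_mem hs⟩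
      · exact IsCompact.nonempty_sInter_of_directed_nonempty_isCompact_isClosed
          (fun a ha b hb => (hchain.total ha hb).elim
            (fun h => ⟨a, ha, Subset.rfl, h⟩) fun h => ⟨b, hb, h, Subset.rfl⟩)
          (fun s hs => (hc hs).1) (fun s hs => (hc hs).2.1) (fun s hs => (hc hs).2.1.isClosed)
      · obtain ⟨s, hs⟩ := hcne
        exact (hc hs).2.1.of_isClosed_subset
          (isClosed_sInter fun t ht => (hc ht).2.1.isClosed) (sInter_subset_of_mem hs)
      · exact fun x hx t s hs => (hc hs).2.2 x (hx s hs) t) K ⟨hne, hK, hinv⟩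
  refine ⟨Γ, hΓK, hΓ.prop.1, hΓ.prop.2.1, hΓ.prop.2.2, fun K' hsub hne' hcl hinv' => ?_⟩
  exact hsub.antisymm
    (hΓ.le_of_le ⟨hne', hΓ.prop.2.1.of_isClosed_subset hcl hsub, hinv'⟩ hsub)

/-- Every orbit of a compact minimal set visits every open set that meets it. -/
theorem IsCompactMinimalSet.exists_mem_of_isOpen {φ : ℝ → M → M} {Γ O : Set M}
    (hφcont : ∀ t, Continuous (φ t)) (hφzero : ∀ x : M, φ 0 x = x)
    (hφadd : ∀ s t : ℝ, ∀ x : M, φ s (φ t x) = φ (s + t) x)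
    (hΓ : IsCompactMinimalSet φ Γ) (hO : IsOpen O) (hΓO : (Γ ∩ O).Nonempty) {z : M}
    (hz : z ∈ Γ) : ∃ t, φ t z ∈ O := by
  by_contra! h
  have heq : Γ ∩ ⋂ t, φ t ⁻¹' Oᶜ = Γ := by
    refine hΓ.2.2.2 _ inter_subset_left ⟨z, hz, mem_iInter.2 h⟩
      (hΓ.2.1.isClosed.inter (isClosed_iInter fun t => hO.isClosed_compl.preimage (hφcont t))) ?_
    refine fun x hx t => ⟨hΓ.2.2.1 x hx.1 t, mem_iInter.2 fun s => ?_⟩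
    simpa only [mem_preimage, hφadd] using mem_iInter.1 hx.2 (s + t)
  obtain ⟨y, hyΓ, hyO⟩ := hΓO
  exact mem_iInter.1 (heq.ge hyΓ).2 0 (by simpa only [hφzero] using hyO)

/-- If a Lyapunov stable set contained in an open set meets the ω-limit set of `x`, then the ω-limit
sets of the points close to `x` are contained in that open set. -/
theorem IsLyapunovStable.eventually_omegaLimit_subset {φ : ℝ → M → M} {Γ O : Set M} {x : M}
    (hφcont : ∀ t, Continuous (φ t)) (hφadd : ∀ s t : ℝ, ∀ x : M, φ s (φ t x) = φ (s + t) x)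
    (hstab : IsLyapunovStable φ Γ) (hΓ : IsCompact Γ) (hx : (Γ ∩ ω⁺ φ {x}).Nonempty)
    (hO : IsOpen O) (hΓO : Γ ⊆ O) : ∀ᶠ y in 𝓝 x, ω⁺ φ {y} ⊆ O := by
  obtain ⟨C, hC, hΓC, hCO⟩ : ∃ C, IsClosed C ∧ C ∈ 𝓝ˢ Γ ∧ C ⊆ O := by
    obtain ⟨W, hW, hΓW, hWO⟩ := hΓ.exists_isOpen_closure_subset (hO.mem_nhdsSet.2 hΓO)
    exact ⟨closure W, isClosed_closure,
      mem_of_superset (hW.mem_nhdsSet.2 hΓW) subset_closure, hWO⟩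
  obtain ⟨V, hV, hVC, hVpos⟩ := hstab C hΓC
  obtain ⟨p, hpΓ, hp⟩ := hx
  rw [mem_omegaLimit_singleton_iff_mapClusterPt] at hp
  obtain ⟨t, ht⟩ := (hp.frequently
    (isOpen_interior.mem_nhds (subset_interior_iff_mem_nhdsSet.2 hV hpΓ))).exists
  filter_upwards [(hφcont t).continuousAt.preimage_mem_nhds (isOpen_interior.mem_nhds ht)] with y hy
  refine (omegaLimit_subset_closure_image2 _ _ _ (Ici_mem_atTop t)).trans
    ((closure_minimal ?_ hC).trans hCO)
  rintro _ ⟨s, hs, z, rfl, rfl⟩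
  have := hVpos _ (interior_subset hy) (s - t) (sub_nonneg.2 hs)
  rw [hφadd, sub_add_cancel] at this
  exact hVC this

theorem minimals_in_U_compact_connected [LocallyCompactSpace M] [ConnectedSpace M] [LocallyConnectedSpace M]
    (φ : ℝ → M → M)
    (hφcont : Continuous fun p : ℝ × M => φ p.1 p.2)
    (hφzero : ∀ x : M, φ 0 x = x)
    (hφadd : ∀ s t : ℝ, ∀ x : M, φ s (φ t x) = φ (s + t) x)
    (U : Set M) (hUne : U.Nonempty) (hUcomp : IsCompact U) (hUconn : IsConnected U)
    (hUpos : IsPosInvariant φ U)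
    (hmin : ∀ Γ : Set M, Γ ⊆ U → IsCompactMinimalSet φ Γ → IsHyperStable φ Γ) :
    IsCompact {Γ : NonemptyCompacts M | (Γ : Set M) ⊆ U ∧ IsCompactMinimalSet φ (Γ : Set M)} ∧
      IsConnected {Γ : NonemptyCompacts M | (Γ : Set M) ⊆ U ∧ IsCompactMinimalSet φ (Γ : Set M)} := by
  have hφt : ∀ t, Continuous (φ t) := fun t => hφcont.comp (Continuous.prodMk_right t)
  have hclos : ∀ x ∈ U, closure (image2 φ (Ici 0) {x}) ⊆ U := fun x hx =>
    closure_minimal (by rintro _ ⟨s, hs, z, rfl, rfl⟩; exact hUpos _ hx s hs) hUcomp.isClosed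
  have hωsub : ∀ x ∈ U, ω⁺ φ {x} ⊆ U := fun x hx =>
    (omegaLimit_subset_closure_image2 _ _ _ (Ici_mem_atTop 0)).trans (hclos x hx)
  have hωne : ∀ x ∈ U, (ω⁺ φ {x}).Nonempty := fun x hx =>
    nonempty_omegaLimit_of_isCompact_absorbing _ _ _ hUcomp
      ⟨Ici 0, Ici_mem_atTop 0, hclos x hx⟩ (singleton_nonempty x)
  have hωcomp : ∀ x ∈ U, IsCompact (ω⁺ φ {x}) := fun x hx =>
    hUcomp.of_isClosed_subset (isClosed_omegaLimit _ _ _) (hωsub x hx)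
  have hωinv : ∀ x, IsFlowInvariant φ (ω⁺ φ {x}) := fun x y hy t =>
    Flow.isInvariant_omegaLimit atTop ⟨φ, hφcont, fun s t x => (hφadd s t x).symm, hφzero⟩ {x}
      (fun t => tendsto_atTop_add_const_left _ t tendsto_id) t hy
  have hstab : ∀ Γ ⊆ U, IsCompactMinimalSet φ Γ → IsLyapunovStable φ Γ := by
    intro Γ hΓU hΓ
    by_contra hunst
    obtain ⟨-, W, hW, hWΓ⟩ := hmin Γ hΓU hΓ
    have := hWΓ Γ hΓ hunst
    rw [inter_eq_left.2 (subset_of_mem_nhdsSet hW)] at this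
    exact hΓ.1.ne_empty this
  have hωeq : ∀ x, ∀ Γ ⊆ U, IsCompactMinimalSet φ Γ → (Γ ∩ ω⁺ φ {x}).Nonempty →
      ω⁺ φ {x} ⊆ Γ := by
    intro x Γ hΓU hΓ hne y hy
    by_contra hyΓ
    exact ((hstab Γ hΓU hΓ).eventually_omegaLimit_subset hφt hφadd hΓ.2.1 hne
      isOpen_compl_singleton (subset_compl_singleton_iff.2 hyΓ)).self_of_nhds hy rfl
  have hωmin : ∀ x ∈ U, IsCompactMinimalSet φ (ω⁺ φ {x}) := by
    intro x hx
    obtain ⟨Γ, hΓω, hΓ⟩ := (hωinv x).exists_compactMinimalSet_subset (hωne x hx) (hωcomp x hx)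
    rwa [(hωeq x Γ (hΓω.trans (hωsub x hx)) hΓ (by rw [inter_eq_left.2 hΓω]; exact hΓ.1)).antisymm
      hΓω]
  let f : U → NonemptyCompacts M := fun x => ⟨⟨ω⁺ φ {x.1}, hωcomp x x.2⟩, hωne x x.2⟩
  have hupper : ∀ O, IsOpen O → IsOpen {x : U | ω⁺ φ {x.1} ⊆ O} := by
    refine fun O hO => isOpen_iff_mem_nhds.2 fun x hx => ?_
    have := (hstab _ (hωsub x x.2) (hωmin x x.2)).eventually_omegaLimit_subset hφt hφadd
      (hωcomp x x.2) (by rw [inter_self]; exact hωne x x.2) hO hx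
    exact continuous_subtype_val.continuousAt.eventually this
  have hf : Continuous f := by
    refine continuous_induced_rng.2 (continuous_generateFrom_iff.2 ?_)
    rintro _ (⟨O, hO, rfl⟩ | ⟨O, hO, rfl⟩)
    · exact hupper O hO
    · convert! hupper (⋃ t, φ t ⁻¹' O) (isOpen_iUnion fun t => hO.preimage (hφt t)) using 1
      ext x
      refine ⟨fun h z hz => mem_iUnion.2 ?_, fun h => ?_⟩
      · exact (hωmin x x.2).exists_mem_of_isOpen hφt hφzero hφadd hO h hz
      · obtain ⟨z, hz⟩ := hωne x x.2
        obtain ⟨t, ht⟩ := mem_iUnion.1 (h hz)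
        exact ⟨φ t z, hωinv x z hz t, ht⟩
  have hrange : range f =
      {Γ : NonemptyCompacts M | (Γ : Set M) ⊆ U ∧ IsCompactMinimalSet φ (Γ : Set M)} := by
    refine Subset.antisymm (range_subset_iff.2 fun x => ⟨hωsub x x.2, hωmin x x.2⟩) ?_
    rintro Γ ⟨hΓU, hΓ⟩
    obtain ⟨x, hx⟩ := Γ.nonempty
    refine ⟨⟨x, hΓU hx⟩, NonemptyCompacts.ext ?_⟩
    refine hΓ.2.2.2 _ ?_ (hωne x (hΓU hx)) (isClosed_omegaLimit _ _ _) (hωinv x)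
    refine (omegaLimit_subset_closure_image2 _ _ _ univ_mem).trans
      (closure_minimal ?_ hΓ.2.1.isClosed)
    rintro _ ⟨s, -, z, rfl, rfl⟩
    exact hΓ.2.2.1 _ hx s
  have : CompactSpace U := isCompact_iff_compactSpace.1 hUcomp
  have : ConnectedSpace U := isConnected_iff_connectedSpace.1 hUconn
  rw [← hrange]
  exact ⟨isCompact_range hf, isConnected_range hf⟩
end

section
/- Every generalized Peano continuum is locally a Peano continuum: if X is a locally compact, connected, locally connected metric space, then for every x ∈ X and every neighborhood U of x there exists a neighborhood V of x with V ⊆ U such that V is compact, connected and locally connected (i.e., V is a Peano continuum). -/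
open Set Filter Topology Metric

/-- The union of `A` with all members of the family `F` that meet `A`. -/
def starEnlarge {X : Type*} (F : Set (Set X)) (A : Set X) : Set X :=
  A ∪ ⋃₀ {P | P ∈ F ∧ (P ∩ A).Nonempty}

/-- The result of enlarging `A` successively along the families `F n, …, F (n + k - 1)`. -/
def iterStar {X : Type*} (F : ℕ → Set (Set X)) (A : Set X) (n : ℕ) : ℕ → Set X
  | 0 => A
  | k + 1 => starEnlarge (F (n + k)) (iterStar F A n k)

theorem starEnlarge_sUnion {X : Type*} (F T : Set (Set X)) :
    starEnlarge F (⋃₀ T) = ⋃ P ∈ T, starEnlarge F P := by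
  ext y
  simp only [starEnlarge, mem_union, mem_sUnion, mem_iUnion, mem_ofPred_eq, Set.Nonempty,
    mem_inter_iff, exists_prop]
  constructor
  · rintro (⟨P, hP, hy⟩ | ⟨Q, ⟨hQ, z, hz, P, hP, hzP⟩, hy⟩)
    · exact ⟨P, hP, Or.inl hy⟩
    · exact ⟨P, hP, Or.inr ⟨Q, ⟨hQ, z, hz, hzP⟩, hy⟩⟩
  · rintro ⟨P, hP, hy | ⟨Q, ⟨hQ, z, hz, hzP⟩, hy⟩⟩
    · exact Or.inl ⟨P, hP, hy⟩
    · exact Or.inr ⟨Q, ⟨hQ, z, hz, P, hP, hzP⟩, hy⟩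

theorem iterStar_sUnion {X : Type*} (F : ℕ → Set (Set X)) (T : Set (Set X)) (n k : ℕ) :
    iterStar F (⋃₀ T) n k = ⋃ P ∈ T, iterStar F P n k := by
  induction k with
  | zero => simp [iterStar, sUnion_eq_biUnion]
  | succ k ih =>
    simp only [iterStar]
    rw [ih, ← sUnion_image, starEnlarge_sUnion, biUnion_image]

theorem iterStar_add {X : Type*} (F : ℕ → Set (Set X)) (A : Set X) (n m k : ℕ) :
    iterStar F A n (m + k) = iterStar F (iterStar F A n m) (n + m) k := by
  induction k with
  | zero => rfl
  | succ k ih => rw [← add_assoc]; simp only [iterStar]; rw [ih, add_assoc]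

theorem monotone_iterStar {X : Type*} (F : ℕ → Set (Set X)) (A : Set X) (n : ℕ) :
    Monotone (iterStar F A n) :=
  monotone_nat_of_le_succ fun _ => subset_union_left

theorem IsPreconnected.starEnlarge {X : Type*} [TopologicalSpace X] {F : Set (Set X)}
    {A : Set X} (hF : ∀ P ∈ F, IsPreconnected P) (hA : IsPreconnected A) :
    IsPreconnected (starEnlarge F A) := by
  refine isPreconnected_of_forall_pair ?_
  have key : ∀ y ∈ _root_.starEnlarge F A, ∃ t ⊆ _root_.starEnlarge F A,
      A ⊆ t ∧ y ∈ t ∧ (t ∩ A).Nonempty ∧ IsPreconnected t := by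
    rintro y (hy | ⟨P, ⟨hP, hPA⟩, hy⟩)
    · exact ⟨A, subset_union_left, Subset.rfl, hy, ⟨y, hy, hy⟩, hA⟩
    · obtain ⟨z, hzP, hzA⟩ := hPA
      exact ⟨A ∪ P, union_subset_union_right _ (subset_sUnion_of_mem ⟨hP, z, hzP, hzA⟩),
        subset_union_left, Or.inr hy, ⟨z, Or.inl hzA, hzA⟩, hA.union z hzA hzP (hF P hP)⟩
  intro y hy z hz
  obtain ⟨s, hs, hAs, hys, ⟨w, -, hw⟩, hsc⟩ := key y hy
  obtain ⟨t, ht, hAt, hzt, -, htc⟩ := key z hz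
  exact ⟨s ∪ t, union_subset hs ht, Or.inl hys, Or.inr hzt, hsc.union w (hAs hw) (hAt hw) htc⟩

theorem IsPreconnected.iterStar {X : Type*} [TopologicalSpace X] {F : ℕ → Set (Set X)}
    {A : Set X} (hF : ∀ n, ∀ P ∈ F n, IsPreconnected P) (hA : IsPreconnected A) (n k : ℕ) :
    IsPreconnected (iterStar F A n k) := by
  induction k with
  | zero => exact hA
  | succ k ih => exact ih.starEnlarge (hF _)

theorem IsPreconnected.iUnion_iterStar {X : Type*} [TopologicalSpace X] {F : ℕ → Set (Set X)}
    {A : Set X} (hF : ∀ n, ∀ P ∈ F n, IsPreconnected P) (hA : IsPreconnected A) (n : ℕ) :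
    IsPreconnected (⋃ k, _root_.iterStar F A n k) := by
  rcases A.eq_empty_or_nonempty with rfl | ⟨a, ha⟩
  · have h := iterStar_sUnion F ∅ n
    simp only [sUnion_empty, mem_empty_iff_false, iUnion_of_empty, iUnion_empty] at h
    simp [h, isPreconnected_empty]
  · refine isPreconnected_iUnion ⟨a, mem_iInter.2 fun k => ?_⟩ fun k => hA.iterStar hF n k
    exact monotone_iterStar F A n (Nat.zero_le k) ha

theorem exists_dist_le_of_mem_iterStar {X : Type*} [PseudoMetricSpace X] {F : ℕ → Set (Set X)}
    {c : ℝ} (hc : 0 ≤ c) (hF : ∀ n, ∀ P ∈ F n, ∀ p ∈ P, ∀ q ∈ P, dist p q ≤ c / 2 ^ n)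
    (A : Set X) (n k : ℕ) {y : X} (hy : y ∈ iterStar F A n k) :
    ∃ a ∈ A, dist a y ≤ 2 * (c / 2 ^ n) := by
  suffices h : ∃ a ∈ A, dist a y ≤ 2 * (c / 2 ^ n) - 2 * (c / 2 ^ (n + k)) by
    obtain ⟨a, ha, h⟩ := h
    have : 0 ≤ c / 2 ^ (n + k) := by positivity
    exact ⟨a, ha, by linarith⟩
  induction k generalizing y with
  | zero => exact ⟨y, hy, by simp⟩
  | succ k ih =>
    have h0 : 0 ≤ c / 2 ^ (n + k) := by positivity
    have h1 : c / 2 ^ (n + (k + 1)) = c / 2 ^ (n + k) / 2 := by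
      rw [← add_assoc, pow_succ, div_mul_eq_div_div]
    rw [h1]
    rcases hy with hy | ⟨P, ⟨hP, z, hzP, hz⟩, hy⟩
    · obtain ⟨a, ha, h⟩ := ih hy
      exact ⟨a, ha, by linarith⟩
    · obtain ⟨a, ha, h⟩ := ih hz
      exact ⟨a, ha, by linarith [dist_triangle a z y, hF _ P hP z hzP y hy]⟩

/-- In a locally connected metric space, a compact set is covered by finitely many open connected
sets of small diameter. -/
theorem IsCompact.exists_finite_isPreconnected_cover {X : Type*} [PseudoMetricSpace X]
    [LocallyConnectedSpace X] {K : Set X} (hK : IsCompact K) {ε : ℝ} (hε : 0 < ε) :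
    ∃ F : Set (Set X), F.Finite ∧ (∀ P ∈ F, IsOpen P) ∧ (∀ P ∈ F, IsPreconnected P) ∧
      (∀ P ∈ F, ∀ p ∈ P, ∀ q ∈ P, dist p q ≤ ε) ∧ K ⊆ ⋃₀ F := by
  obtain ⟨t, -, ht⟩ := hK.elim_nhds_subcover
    (fun y => connectedComponentIn (ball y (ε / 2)) y)
    fun y _ => connectedComponentIn_mem_nhds (ball_mem_nhds y (half_pos hε))
  refine ⟨(fun y => connectedComponentIn (ball y (ε / 2)) y) '' t, t.finite_toSet.image _,
    ?_, ?_, ?_, ?_⟩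
  · rintro _ ⟨y, -, rfl⟩
    exact isOpen_ball.connectedComponentIn
  · rintro _ ⟨y, -, rfl⟩
    exact isPreconnected_connectedComponentIn
  · rintro _ ⟨y, -, rfl⟩ p hp q hq
    have hp' := mem_ball.1 (connectedComponentIn_subset _ _ hp)
    have hq' := mem_ball.1 (connectedComponentIn_subset _ _ hq)
    linarith [dist_triangle_right p q y]
  · simpa [sUnion_image] using ht

/-- A set which, for every `ε > 0`, is a finite union of closed connected sets of diameter at most
`ε` is locally connected. -/
theorem locallyConnectedSpace_of_finite_closed_cover {X : Type*} [PseudoMetricSpace X] {V : Set X}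
    (h : ∀ ε > 0, ∃ T : Set (Set X), T.Finite ∧ (∀ P ∈ T, IsClosed P) ∧
      (∀ P ∈ T, IsPreconnected P) ∧ (∀ P ∈ T, ∀ p ∈ P, ∀ q ∈ P, dist p q ≤ ε) ∧ ⋃₀ T = V) :
    LocallyConnectedSpace V := by
  refine locallyConnectedSpace_iff_connected_subsets.2 fun x U hU => ?_
  obtain ⟨ε, hε, hball⟩ := Metric.mem_nhds_iff.1 hU
  obtain ⟨T, hfin, hcl, hconn, hdiam, rfl⟩ := h (ε / 2) (half_pos hε)
  have hW : ⋃₀ {P | P ∈ T ∧ (x : X) ∈ P} ⊆ ⋃₀ T := sUnion_subset_sUnion fun P hP => hP.1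
  refine ⟨Subtype.val ⁻¹' ⋃₀ {P | P ∈ T ∧ (x : X) ∈ P}, ?_, ?_, ?_⟩
  · have hC : IsClosed (⋃₀ {P | P ∈ T ∧ (x : X) ∉ P}) := by
      rw [sUnion_eq_biUnion]
      exact (hfin.subset fun P hP => hP.1).isClosed_biUnion fun P hP => hcl P hP.1
    have hx : (x : X) ∈ (⋃₀ {P | P ∈ T ∧ (x : X) ∉ P})ᶜ := by
      rintro ⟨P, hP, hxP⟩
      exact hP.2 hxP
    filter_upwards [(hC.isOpen_compl.preimage continuous_subtype_val).mem_nhds hx] with y hy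
    obtain ⟨P, hP, hyP⟩ := y.2
    by_cases hxP : (x : X) ∈ P
    · exact ⟨P, ⟨hP, hxP⟩, hyP⟩
    · exact absurd ⟨P, ⟨hP, hxP⟩, hyP⟩ hy
  · rw [← IsInducing.subtypeVal.isPreconnected_image, Subtype.image_preimage_coe,
      inter_eq_right.2 hW]
    exact isPreconnected_sUnion (x : X) {P | P ∈ T ∧ (x : X) ∈ P} (fun P hP => hP.2)
      fun P hP => hconn P hP.1
  · rintro y ⟨P, ⟨hP, hxP⟩, hyP⟩
    refine hball (mem_ball.2 ?_)
    have := hdiam P hP y hyP x hxP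
    rw [Subtype.dist_eq]
    linarith

/-- The closure of the union of the iterated stars of a point is locally connected, provided these
stars stay in a set covered by each of the families. -/
theorem locallyConnectedSpace_closure_iUnion_iterStar {X : Type*} [PseudoMetricSpace X]
    {F : ℕ → Set (Set X)} {c : ℝ} (hc : 0 < c) (hfin : ∀ n, (F n).Finite)
    (hconn : ∀ n, ∀ P ∈ F n, IsPreconnected P)
    (hdist : ∀ n, ∀ P ∈ F n, ∀ p ∈ P, ∀ q ∈ P, dist p q ≤ c / 2 ^ n) (A : Set X)
    (hcover : ∀ n, iterStar F A 0 n ⊆ ⋃₀ F n) :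
    LocallyConnectedSpace (closure (⋃ k, iterStar F A 0 k)) := by
  refine locallyConnectedSpace_of_finite_closed_cover fun ε hε => ?_
  obtain ⟨n, hn⟩ : ∃ n : ℕ, 3 * (c / 2 ^ n) < ε := by
    obtain ⟨n, hn⟩ := exists_pow_lt_of_lt_one (show 0 < ε / (3 * c) by positivity)
      (show (1 / 2 : ℝ) < 1 by norm_num)
    refine ⟨n, ?_⟩
    rw [lt_div_iff₀ (by positivity), one_div, inv_pow] at hn
    rw [div_eq_mul_inv]
    linarith
  set T : Set (Set X) := {P | P ∈ F n ∧ (P ∩ iterStar F A 0 n).Nonempty}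
  have hTfin : T.Finite := (hfin n).subset fun P hP => hP.1
  have hstep : iterStar F A 0 (n + 1) = ⋃₀ T := by
    simp only [iterStar, starEnlarge, zero_add]
    refine union_eq_right.2 fun y hy => ?_
    obtain ⟨P, hP, hyP⟩ := hcover n hy
    exact ⟨P, ⟨hP, y, hyP, hy⟩, hyP⟩
  refine ⟨(fun P => closure (⋃ k, iterStar F P (n + 1) k)) '' T, hTfin.image _, ?_, ?_, ?_, ?_⟩
  · rintro _ ⟨P, -, rfl⟩
    exact isClosed_closure
  · rintro _ ⟨P, hP, rfl⟩
    exact ((hconn n P hP.1).iUnion_iterStar hconn (n + 1)).closure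
  · rintro _ ⟨P, hP, rfl⟩ p hp q hq
    have hdiam : ∀ p ∈ ⋃ k, iterStar F P (n + 1) k, ∀ q ∈ ⋃ k, iterStar F P (n + 1) k,
        dist p q ≤ ε := by
      intro p hp q hq
      obtain ⟨i, hi⟩ := mem_iUnion.1 hp
      obtain ⟨j, hj⟩ := mem_iUnion.1 hq
      obtain ⟨a, ha, hap⟩ := exists_dist_le_of_mem_iterStar hc.le hdist P (n + 1) i hi
      obtain ⟨b, hb, hbq⟩ := exists_dist_le_of_mem_iterStar hc.le hdist P (n + 1) j hj
      rw [pow_succ, div_mul_eq_div_div] at hap hbq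
      linarith [dist_triangle4 p a b q, hdist n P hP.1 a ha b hb, dist_comm a p]
    have hclosed : IsClosed {z : X × X | dist z.1 z.2 ≤ ε} :=
      isClosed_le continuous_dist continuous_const
    have hsub : closure ((⋃ k, iterStar F P (n + 1) k) ×ˢ (⋃ k, iterStar F P (n + 1) k)) ⊆
        {z : X × X | dist z.1 z.2 ≤ ε} :=
      hclosed.closure_subset_iff.2 fun z hz => hdiam z.1 hz.1 z.2 hz.2
    rw [closure_prod_eq] at hsub
    exact hsub (show (p, q) ∈ _ from ⟨hp, hq⟩)
  · rw [sUnion_image, ← hTfin.closure_biUnion]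
    congr 1
    have hshift := (monotone_iterStar F A 0).iUnion_nat_add (n + 1)
    rw [← hshift]
    simp only [add_comm _ (n + 1), iterStar_add F A 0 (n + 1), hstep, iterStar_sUnion]
    ext y
    simp only [mem_iUnion, exists_prop]
    exact ⟨fun ⟨P, hP, k, hk⟩ => ⟨k, P, hP, hk⟩, fun ⟨k, P, hP, hk⟩ => ⟨P, hP, k, hk⟩⟩

theorem generalized_peano_continuum_locally_peano
    {X : Type*} [MetricSpace X] [LocallyCompactSpace X] [ConnectedSpace X]
    [LocallyConnectedSpace X] (x : X) (U : Set X) (hU : U ∈ 𝓝 x) :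
    ∃ V ∈ 𝓝 x, V ⊆ U ∧ IsCompact V ∧ IsConnected V ∧ LocallyConnectedSpace ↥V := by
  obtain ⟨K, hKx, hKU, hK⟩ := local_compact_nhds hU
  obtain ⟨r, hr, hrK⟩ := nhds_basis_closedBall.mem_iff.1 hKx
  have hB : IsCompact (closedBall x r) := hK.of_isClosed_subset isClosed_closedBall hrK
  have hc : 0 < r / 2 := half_pos hr
  choose F hfin hopen hconn hdist hcover using fun n : ℕ =>
    hB.exists_finite_isPreconnected_cover (show 0 < r / 2 / 2 ^ n by positivity)
  have hball : ∀ n, iterStar F {x} 0 n ⊆ closedBall x r := by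
    intro n y hy
    obtain ⟨a, rfl, ha⟩ := exists_dist_le_of_mem_iterStar hc.le hdist {x} 0 n hy
    rw [mem_closedBall, dist_comm]
    simp only [pow_zero] at ha
    linarith
  have hVB : closure (⋃ k, iterStar F {x} 0 k) ⊆ closedBall x r :=
    isClosed_closedBall.closure_subset_iff.2 (iUnion_subset hball)
  have hnhds : closure (⋃ k, iterStar F {x} 0 k) ∈ 𝓝 x := by
    obtain ⟨P, hP, hxP⟩ := hcover 0 (mem_closedBall_self hr.le)
    refine mem_of_superset ((hopen 0 P hP).mem_nhds hxP) fun y hy => subset_closure ?_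
    exact mem_iUnion.2 ⟨1, Or.inr ⟨P, ⟨hP, x, hxP, rfl⟩, hy⟩⟩
  exact ⟨_, hnhds, hVB.trans (hrK.trans hKU), hB.of_isClosed_subset isClosed_closure hVB,
    ⟨⟨x, mem_of_mem_nhds hnhds⟩, (isPreconnected_singleton.iUnion_iterStar hconn 0).closure⟩,
    locallyConnectedSpace_closure_iUnion_iterStar hc hfin hconn hdist {x}
      fun n => (hball n).trans (hcover n)⟩
end
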